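/- Under the Lemma 6 setup (see context), the set B₀ ∖ {y−1} contains no element b such that b + 1 ∈ Y. -/

import Mathlib

open Finset

/-- `s^{n,k} = (n(n+1)/2)/k`. -/
def magicConst (n k : ℕ) : ℕ := (n * (n + 1) / 2) / k

/-- `A` is a partition of `[n] = {1,…,n}` into `k` (indexed) parts. -/
def IsPartitionOn (n : ℕ) {k : ℕ} (A : Fin k → Finset ℕ) : Prop :=
  (∀ i j : Fin k, i ≠ j → Disjoint (A i) (A j)) ∧
    Finset.univ.biUnion A = Finset.Icc 1 n

/-- The partition `A` of `[n]` implements the sequence of sizes `p` (up to reindexing). -/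
def Implements (n : ℕ) {k : ℕ} (A : Fin k → Finset ℕ) (p : Fin k → ℕ) : Prop :=
  IsPartitionOn n A ∧ ∃ e : Equiv.Perm (Fin k), ∀ i, (A (e i)).card = p i

/-- Every part of the partition has sum `s^{n,k}`. -/
def Equitable (n : ℕ) {k : ℕ} (A : Fin k → Finset ℕ) : Prop :=
  ∀ i, (A i).sum id = magicConst n k

/-- `d(A) = Σ_i (S(A_i) − s^{n,k})²`. -/
def dVal (n : ℕ) {k : ℕ} (A : Fin k → Finset ℕ) : ℤ :=
  ∑ i : Fin k, ((((A i).sum id : ℕ) : ℤ) - (magicConst n k : ℤ)) ^ 2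

/-- A partition implementing `p` minimizing `d` among all partitions implementing `p`. -/
def MinimalPartition (n : ℕ) {k : ℕ} (A : Fin k → Finset ℕ) (p : Fin k → ℕ) : Prop :=
  Implements n A p ∧ ∀ B : Fin k → Finset ℕ, Implements n B p → dVal n A ≤ dVal n B

/-- Condition (★): `Σ_{i=1}^{P_j} (n−i+1) ≥ j·s^{n,k}` for all `j = 1,…,k`,
where `P_j = p_1 + ⋯ + p_j`. -/
def StarCond (n k : ℕ) (p : Fin k → ℕ) : Prop :=
  ∀ j : Fin k,
    ((j : ℕ) + 1) * magicConst n k ≤ ∑ i ∈ Finset.range (∑ t ∈ Finset.Iic j, p t), (n - i)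

/-- The width `ω(A)` of a partition: the minimum of `y − x` over pairs `x < y` with `x`
in a low set and `y` in a high set (`⊤` if there is no such pair). -/
noncomputable def width (n : ℕ) {k : ℕ} (A : Fin k → Finset ℕ) : ℕ∞ :=
  sInf { w : ℕ∞ | ∃ (x y : ℕ) (i j : Fin k), x ∈ A i ∧ y ∈ A j ∧ x < y ∧
    (A i).sum id < magicConst n k ∧ magicConst n k < (A j).sum id ∧ w = (y - x : ℕ) }

/-- Exchanging two elements of `[n]` in every part preserves the sizes of the parts. -/
theorem Implements.map_swap {n k : ℕ} {A : Fin k → Finset ℕ} {p : Fin k → ℕ}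
    (h : Implements n A p) {a b : ℕ} (ha : a ∈ Icc 1 n) (hb : b ∈ Icc 1 n) :
    Implements n (fun i => (A i).map (Equiv.swap a b).toEmbedding) p := by
  obtain ⟨⟨hdisj, hunion⟩, e, he⟩ := h
  refine ⟨⟨fun i j hij => (disjoint_map _).2 (hdisj i j hij), ?_⟩, e, fun i => ?_⟩
  · ext m
    have key : ∀ m, m ∈ Icc 1 n ↔ ∃ i, m ∈ A i := fun m => by simp [← hunion]
    have hm : (Equiv.swap a b) m ∈ Icc 1 n ↔ m ∈ Icc 1 n := by
      rw [Equiv.swap_apply_def]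
      split_ifs with h1 h2
      · subst h1; simp only [ha, hb]
      · subst h2; simp only [ha, hb]
      · rfl
    rw [← hm, key]
    simp [mem_map_equiv]
  · rw [card_map, he]

theorem sum_map_swap_of_notMem {S : Finset ℕ} {a b : ℕ} (ha : a ∉ S) (hb : b ∉ S) :
    (S.map (Equiv.swap a b).toEmbedding).sum id = S.sum id := by
  rw [sum_map]
  refine sum_congr rfl fun m hm => ?_
  exact Equiv.swap_apply_of_ne_of_ne (ne_of_mem_of_not_mem hm ha) (ne_of_mem_of_not_mem hm hb)

theorem sum_map_swap_of_mem {S : Finset ℕ} {a b : ℕ} (ha : a ∈ S) (hb : b ∉ S) :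
    (S.map (Equiv.swap a b).toEmbedding).sum id + a = S.sum id + b := by
  have h : ∑ m ∈ S.erase a, Equiv.swap a b m = ∑ m ∈ S.erase a, m :=
    sum_congr rfl fun m hm => Equiv.swap_apply_of_ne_of_ne (ne_of_mem_erase hm)
      (ne_of_mem_of_not_mem (mem_of_mem_erase hm) hb)
  rw [sum_map, ← add_sum_erase S _ ha, ← add_sum_erase S _ ha]
  simp only [Equiv.coe_toEmbedding, id, Equiv.swap_apply_left, h]
  ring

/-- Two elements of a low and a high part bound the width. -/
theorem width_le {n k : ℕ} {A : Fin k → Finset ℕ} {x y : ℕ} {i j : Fin k} (hx : x ∈ A i)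
    (hy : y ∈ A j) (hxy : x < y) (hi : (A i).sum id < magicConst n k)
    (hj : magicConst n k < (A j).sum id) : width n A ≤ ((y - x : ℕ) : ℕ∞) :=
  sInf_le ⟨x, y, i, j, hx, hy, hxy, hi, hj, rfl⟩

/-- Lemma 6(iv). -/
theorem stmt_16 (n : ℕ) (hn : 0 < n) (hdvd : 4 ∣ n * (n + 1) / 2)
    (p : Fin 4 → ℕ) (hp : ∀ i, 0 < p i)
    (X Y Z W : Finset ℕ)
    (hmin : MinimalPartition n ![X, Y, Z, W] p)
    (hminw : ∀ B : Fin 4 → Finset ℕ, MinimalPartition n B p →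
      width n ![X, Y, Z, W] ≤ width n B)
    (hfin : width n ![X, Y, Z, W] ≠ ⊤)
    (hX : X.sum id + 1 = magicConst n 4)
    (hY : Y.sum id = magicConst n 4 + 1)
    (hZ : Z.sum id = magicConst n 4) (hW : W.sum id = magicConst n 4)
    (x y : ℕ) (hx : x ∈ X) (hy : y ∈ Y) (hxy : x < y)
    (hw : width n ![X, Y, Z, W] = ((y - x : ℕ) : ℕ∞))
    (A₀ B₀ : Finset ℕ) (hA₀ : A₀ = Z ∨ A₀ = W) (hB₀ : B₀ = Z ∨ B₀ = W)
    (hxA : x + 1 ∈ A₀) (hyB : y - 1 ∈ B₀) :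
    ∀ b : ℕ, b ∈ B₀ → b ≠ y - 1 → b + 1 ∉ Y := by
  intro b hb hby hbY
  have hdisj := hmin.1.1.1
  have hsub : ∀ i m, m ∈ ![X, Y, Z, W] i → m ∈ Icc 1 n := fun i m hm => by
    rw [← hmin.1.1.2]
    exact mem_biUnion.2 ⟨i, mem_univ i, hm⟩
  have hne : ∀ i j m, m ∈ ![X, Y, Z, W] i → i ≠ j → m ∉ ![X, Y, Z, W] j :=
    fun i j m hi hij => disjoint_left.1 (hdisj i j hij) hi
  obtain ⟨j, l, hj1, hj0, hl0, hl1, hjl, hjB, hsums⟩ : ∃ j l : Fin 4, j ≠ 1 ∧ j ≠ 0 ∧ l ≠ 0 ∧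
      l ≠ 1 ∧ j ≠ l ∧ ![X, Y, Z, W] j = B₀ ∧
      ∀ f : Fin 4 → ℤ, ∑ i, f i = f 0 + f 1 + f j + f l := by
    rcases hB₀ with rfl | rfl
    · exact ⟨2, 3, by decide, by decide, by decide, by decide, by decide, rfl,
        fun f => Fin.sum_univ_four f⟩
    · exact ⟨3, 2, by decide, by decide, by decide, by decide, by decide, rfl,
        fun f => by rw [Fin.sum_univ_four]; ring⟩
  have hBsum : B₀.sum id = magicConst n 4 := by
    rcases hB₀ with rfl | rfl <;> assumption
  rw [← hjB] at hb hyB hBsum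
  have hbY' : b + 1 ∈ ![X, Y, Z, W] 1 := hbY
  have himp := hmin.1.map_swap (hsub j b hb) (hsub 1 (b + 1) hbY')
  have h0 := sum_map_swap_of_notMem (hne j 0 b hb hj0) (hne 1 0 (b + 1) hbY' (by decide))
  have hl := sum_map_swap_of_notMem (hne j l b hb hjl) (hne 1 l (b + 1) hbY' hl1.symm)
  have hj := sum_map_swap_of_mem hb (hne 1 j (b + 1) hbY' hj1.symm)
  have h1 := sum_map_swap_of_mem hbY' (hne j 1 b hb hj1)
  rw [Equiv.swap_comm] at h1
  have hY' : (![X, Y, Z, W] 1).sum id = magicConst n 4 + 1 := hY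
  have hX' : (![X, Y, Z, W] 0).sum id + 1 = magicConst n 4 := hX
  have hd : dVal n (fun i => (![X, Y, Z, W] i).map (Equiv.swap b (b + 1)).toEmbedding) =
      dVal n ![X, Y, Z, W] := by
    have e1 : ((![X, Y, Z, W] 1).map (Equiv.swap b (b + 1)).toEmbedding).sum id =
      magicConst n 4 := by omega
    have e2 : ((![X, Y, Z, W] j).map (Equiv.swap b (b + 1)).toEmbedding).sum id =
      magicConst n 4 + 1 := by omega
    simp only [dVal, hsums]
    rw [h0, hl, e1, e2, hY', hBsum]
    ring
  have hminB : MinimalPartition n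
      (fun i => (![X, Y, Z, W] i).map (Equiv.swap b (b + 1)).toEmbedding) p :=
    ⟨himp, fun C hC => hd.trans_le (hmin.2 C hC)⟩
  have hxy' : x < y - 1 := by
    have : x ≠ y - 1 := fun h => hne j 0 (y - 1) hyB hj0 (h ▸ hx)
    omega
  have hx0 : x ∈ ![X, Y, Z, W] 0 := hx
  have hle := (hminw _ hminB).trans (width_le (i := 0) (j := j) (x := x) (y := y - 1)
    (mem_map_equiv.2 ?_) (mem_map_equiv.2 ?_) hxy' (by omega) (by omega))
  · rw [hw, Nat.cast_le] at hle
    omega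
  · rwa [Equiv.symm_swap, Equiv.swap_apply_of_ne_of_ne]
    · exact ne_of_mem_of_not_mem hx0 (hne j 0 b hb hj0)
    · exact ne_of_mem_of_not_mem hx0 (hne 1 0 _ hbY' (by decide))
  · rwa [Equiv.symm_swap, Equiv.swap_apply_of_ne_of_ne]
    · exact hby.symm
    · exact ne_of_mem_of_not_mem hyB (hne 1 j _ hbY' hj1.symm)
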